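/- arXiv:2306.03301 — 4 statements merged into one kernel-verified Lean document; each statement's English description precedes it below -/
import Mathlib

section
/- (Theorem 1, value-network part, pointwise form) Fix a subset S ⊆ {1,…,d}, an index i ∉ S, and a value x_S with P(X_S = x_S) > 0. The function v ↦ E[(v − Δ(x_S, X_i, Y))² | X_S = x_S] on ℝ attains its minimum uniquely at v = I(Y; X_i | X_S = x_S). -/
open MeasureTheory ProbabilityTheory
open scoped ENNReal NNReal

noncomputable section

variable {Ω : Type}

/-- Conditional probability of `B` given `A`, as a real number. -/
def cpr [MeasureSpace Ω] (A B : Set Ω) : ℝ :=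
  (((ℙ : Measure Ω)[|A]) B).toReal

/-- Conditional expectation of `g` given the event `A`. -/
def cexp [MeasureSpace Ω] (A : Set Ω) (g : Ω → ℝ) : ℝ :=
  ∫ ω, g ω ∂((ℙ : Measure Ω)[|A])

/-- Conditional variance of `g` given the event `A`. -/
def cvar [MeasureSpace Ω] (A : Set Ω) (g : Ω → ℝ) : ℝ :=
  variance g ((ℙ : Measure Ω)[|A])

/-- Conditional pmf of `Y` given the event `A`. -/
def cpmf {𝒴 : Type} [MeasureSpace Ω] (Y : Ω → 𝒴) (A : Set Ω) (y : 𝒴) : ℝ :=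
  cpr A {ω | Y ω = y}

/-- Cross-entropy loss `ℓ(q, y) = -log q(y)`. -/
def xent {𝒴 : Type} (q : 𝒴 → ℝ) (y : 𝒴) : ℝ := -Real.log (q y)

/-- `q` is a probability mass function on the finite type `𝒴`. -/
def IsPMF {𝒴 : Type} [Fintype 𝒴] (q : 𝒴 → ℝ) : Prop :=
  (∀ y, 0 ≤ q y) ∧ ∑ y, q y = 1

/-- Conditional entropy `H(Y | A)` of the finitely-valued `Y` on the event `A`. -/
def entropyOn {𝒴 : Type} [MeasureSpace Ω] [Fintype 𝒴] (Y : Ω → 𝒴) (A : Set Ω) : ℝ :=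
  -∑ y, cpmf Y A y * Real.log (cpmf Y A y)

/-- Kullback–Leibler divergence between pmfs on a finite type. -/
def klDivFin {𝒴 : Type} [Fintype 𝒴] (p q : 𝒴 → ℝ) : ℝ :=
  ∑ y, p y * Real.log (p y / q y)

/-- Conditional mutual information `I(Y; Xi | A)` on the event `A`. -/
def cmi {𝒴 𝒳i : Type} [MeasureSpace Ω] [Fintype 𝒴] [Fintype 𝒳i]
    (Y : Ω → 𝒴) (Xi : Ω → 𝒳i) (A : Set Ω) : ℝ :=
  entropyOn Y A - ∑ xi, cpr A {ω | Xi ω = xi} * entropyOn Y (A ∩ {ω | Xi ω = xi})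

/-- The event `X_S = x_S`. -/
def evS {d : ℕ} {𝒳 : Fin d → Type} (X : ∀ i, Ω → 𝒳 i) (S : Finset (Fin d))
    (x : ∀ i, 𝒳 i) : Set Ω :=
  {ω | ∀ i ∈ S, X i ω = x i}

/-- `-log t` valued in `[0, ∞]`, with the convention `-log 0 = +∞`. -/
def negLog (t : ℝ) : ℝ≥0∞ := if t = 0 then ⊤ else ENNReal.ofReal (-Real.log t)

lemma measurableSet_evS [MeasurableSpace Ω] {d : ℕ} {𝒳 : Fin d → Type}
    [∀ i, MeasurableSpace (𝒳 i)] [∀ i, MeasurableSingletonClass (𝒳 i)]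
    {X : ∀ i, Ω → 𝒳 i} (hX : ∀ i, Measurable (X i)) (S : Finset (Fin d)) (x : ∀ i, 𝒳 i) :
    MeasurableSet (evS X S x) := by
  have h : evS X S x = ⋂ i ∈ S, X i ⁻¹' {x i} := by
    ext ω
    simp [evS]
  rw [h]
  exact S.measurableSet_biInter fun i _ => hX i (measurableSet_singleton _)

/-- A function of a random variable with values in a finite type is integrable. -/
lemma integrable_comp_of_finite [MeasurableSpace Ω] {μ : Measure Ω} [IsFiniteMeasure μ]
    {α : Type} [Finite α] [MeasurableSpace α] [MeasurableSingletonClass α]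
    {Z : Ω → α} (hZ : Measurable Z) (F : α → ℝ) : Integrable (fun ω => F (Z ω)) μ :=
  (Integrable.of_finite (μ := μ.map Z) (f := F)).comp_measurable hZ

/-- The expectation of a function of a random variable with values in a finite type. -/
lemma integral_comp_eq_sum [MeasurableSpace Ω] {μ : Measure Ω} [IsFiniteMeasure μ]
    {α : Type} [Fintype α] [MeasurableSpace α] [MeasurableSingletonClass α]
    {Z : Ω → α} (hZ : Measurable Z) (F : α → ℝ) :
    ∫ ω, F (Z ω) ∂μ = ∑ a, μ.real {ω | Z ω = a} * F a := by
  rw [← integral_map hZ.aemeasurable (measurable_of_finite F).aestronglyMeasurable,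
    integral_fintype Integrable.of_finite]
  refine Finset.sum_congr rfl fun a _ => ?_
  rw [map_measureReal_apply hZ (measurableSet_singleton a), smul_eq_mul]
  rfl

/-- The mean is the unique minimizer of the mean squared error. -/
lemma integral_sub_sq_lt [MeasurableSpace Ω] {μ : Measure Ω} [IsProbabilityMeasure μ]
    {f : Ω → ℝ} (hf : Integrable f μ) (hf2 : Integrable (fun ω => f ω ^ 2) μ)
    {v : ℝ} (hv : v ≠ ∫ ω, f ω ∂μ) :
    ∫ ω, ((∫ ω', f ω' ∂μ) - f ω) ^ 2 ∂μ < ∫ ω, (v - f ω) ^ 2 ∂μ := by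
  have key (c : ℝ) : ∫ ω, (c - f ω) ^ 2 ∂μ
      = c ^ 2 - 2 * c * (∫ ω, f ω ∂μ) + ∫ ω, f ω ^ 2 ∂μ := by
    have hlin : Integrable (fun ω => c ^ 2 - 2 * c * f ω) μ :=
      (integrable_const _).sub (hf.const_mul _)
    simp_rw [sub_sq]
    rw [integral_add hlin hf2,
      integral_sub (integrable_const _) (hf.const_mul _), integral_const_mul]
    simp
  rw [key, key]
  nlinarith [sq_pos_of_ne_zero (sub_ne_zero.mpr hv)]

/-- The chain rule for conditional probabilities. -/
lemma cpr_inter [MeasureSpace Ω] [IsFiniteMeasure (ℙ : Measure Ω)] {A B : Set Ω}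
    (hA : MeasurableSet A) (hB : MeasurableSet B) (C : Set Ω) :
    cpr A (B ∩ C) = cpr A B * cpr (A ∩ B) C := by
  rw [cpr, cpr, cpr, ← cond_cond_eq_cond_inter hA hB, ← ENNReal.toReal_mul, mul_comm,
    cond_mul_eq_inter hB]

/-- The expected incremental loss improvement is the conditional mutual information. -/
lemma integral_xent_sub_xent [MeasureSpace Ω] [IsFiniteMeasure (ℙ : Measure Ω)]
    {𝒴 𝒳i : Type} [Fintype 𝒴] [MeasurableSpace 𝒴] [MeasurableSingletonClass 𝒴]
    [Fintype 𝒳i] [MeasurableSpace 𝒳i] [MeasurableSingletonClass 𝒳i]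
    {Xi : Ω → 𝒳i} {Y : Ω → 𝒴} (hXi : Measurable Xi) (hY : Measurable Y)
    {A : Set Ω} (hA : MeasurableSet A) :
    ∫ ω, (xent (cpmf Y A) (Y ω) - xent (cpmf Y (A ∩ {ω' | Xi ω' = Xi ω})) (Y ω))
      ∂((ℙ : Measure Ω)[|A]) = cmi Y Xi A := by
  let F : 𝒳i × 𝒴 → ℝ := fun z => xent (cpmf Y (A ∩ {ω | Xi ω = z.1})) z.2
  have hZ : Measurable fun ω => (Xi ω, Y ω) := hXi.prodMk hY
  have hprior : ∫ ω, xent (cpmf Y A) (Y ω) ∂((ℙ : Measure Ω)[|A]) = entropyOn Y A := by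
    rw [integral_comp_eq_sum hY (xent (cpmf Y A)), entropyOn, ← Finset.sum_neg_distrib]
    exact Finset.sum_congr rfl fun y _ => mul_neg _ _
  have hpost : ∫ ω, F (Xi ω, Y ω) ∂((ℙ : Measure Ω)[|A])
      = ∑ a, cpr A {ω | Xi ω = a} * entropyOn Y (A ∩ {ω | Xi ω = a}) := by
    rw [integral_comp_eq_sum hZ F, Fintype.sum_prod_type]
    refine Finset.sum_congr rfl fun a _ => ?_
    rw [entropyOn, ← Finset.sum_neg_distrib, Finset.mul_sum]
    refine Finset.sum_congr rfl fun y _ => ?_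
    have hset : {ω | (Xi ω, Y ω) = (a, y)} = {ω | Xi ω = a} ∩ {ω | Y ω = y} := by
      ext ω
      simp
    have hchain : ((ℙ : Measure Ω)[|A]).real {ω | (Xi ω, Y ω) = (a, y)}
        = cpr A {ω | Xi ω = a} * cpmf Y (A ∩ {ω | Xi ω = a}) y := by
      rw [hset]
      exact cpr_inter hA (hXi (measurableSet_singleton a)) _
    rw [hchain, mul_assoc]
    exact congrArg _ (mul_neg _ _)
  rw [cmi, ← hprior, ← hpost]
  exact integral_sub (integrable_comp_of_finite hY _) (integrable_comp_of_finite hZ F)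

/-- **Theorem 1 (value-network part, pointwise form).** The map
`v ↦ E[(v − Δ(x_S, X_i, Y))² | X_S = x_S]` attains its minimum uniquely at
`v = I(Y; X_i | X_S = x_S)`. -/
theorem value_network_unique_minimizer
    [MeasureSpace Ω] [IsProbabilityMeasure (ℙ : Measure Ω)]
    {𝒴 : Type} [Fintype 𝒴] [MeasurableSpace 𝒴] [MeasurableSingletonClass 𝒴]
    {d : ℕ} {𝒳 : Fin d → Type} [∀ i, Fintype (𝒳 i)]
    [∀ i, MeasurableSpace (𝒳 i)] [∀ i, MeasurableSingletonClass (𝒳 i)]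
    (X : ∀ i, Ω → 𝒳 i) (Y : Ω → 𝒴)
    (hX : ∀ i, Measurable (X i)) (hY : Measurable Y)
    (S : Finset (Fin d)) (i : Fin d) (hi : i ∉ S)
    (x : ∀ j, 𝒳 j) (hpos : 0 < (ℙ : Measure Ω) (evS X S x)) :
    ∀ v : ℝ, v ≠ cmi Y (X i) (evS X S x) →
      cexp (evS X S x) (fun ω =>
          (cmi Y (X i) (evS X S x) - (xent (cpmf Y (evS X S x)) (Y ω)
            - xent (cpmf Y (evS X S x ∩ {ω' | X i ω' = X i ω})) (Y ω))) ^ 2)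
        < cexp (evS X S x) (fun ω =>
            (v - (xent (cpmf Y (evS X S x)) (Y ω)
              - xent (cpmf Y (evS X S x ∩ {ω' | X i ω' = X i ω})) (Y ω))) ^ 2) := by
  intro v hv
  have hA := measurableSet_evS hX S x
  have := cond_isProbabilityMeasure hpos.ne'
  let F : 𝒳 i × 𝒴 → ℝ := fun z => xent (cpmf Y (evS X S x)) z.2
    - xent (cpmf Y (evS X S x ∩ {ω | X i ω = z.1})) z.2
  have hZ : Measurable fun ω => (X i ω, Y ω) := (hX i).prodMk hY
  rw [← integral_xent_sub_xent (hX i) hY hA] at hv ⊢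
  exact integral_sub_sq_lt (integrable_comp_of_finite hZ F)
    (integrable_comp_of_finite hZ fun z => F z ^ 2) hv
end
end

section
/- (Theorem 2, value-network part, pointwise form) Fix a subset S ⊆ {1,…,d}, an index i ∉ S, a value x_S, and a value z of Z with P(X_S = x_S, Z = z) > 0. The function v ↦ E[(v − Δ(x_S, X_i, z, Y))² | X_S = x_S, Z = z] on ℝ attains its minimum uniquely at v = I(Y; X_i | X_S = x_S, Z = z). -/
open MeasureTheory ProbabilityTheory
open scoped ENNReal NNReal

noncomputable section

variable {Ω : Type}

/-- A function of finitely-valued measurable data is integrable for a finite measure. -/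
lemma integrable_comp_of_fintype {β : Type} [MeasurableSpace Ω] {μ : Measure Ω}
    [IsFiniteMeasure μ] [Fintype β] [MeasurableSpace β] [MeasurableSingletonClass β] {W : Ω → β}
    (hW : Measurable W) (f : β → ℝ) : Integrable (fun ω => f (W ω)) μ :=
  (Integrable.of_finite (μ := μ.map W) (f := f)).comp_measurable hW

lemma integral_comp_of_fintype {β : Type} [MeasurableSpace Ω] {μ : Measure Ω}
    [IsFiniteMeasure μ] [Fintype β] [MeasurableSpace β] [MeasurableSingletonClass β] {W : Ω → β}
    (hW : Measurable W) (f : β → ℝ) :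
    ∫ ω, f (W ω) ∂μ = ∑ b, (μ {ω | W ω = b}).toReal * f b := by
  rw [← integral_map hW.aemeasurable (Integrable.of_finite (μ := μ.map W)).aestronglyMeasurable,
    integral_fintype .of_finite]
  refine Finset.sum_congr rfl fun b _ => ?_
  rw [measureReal_def, Measure.map_apply hW (measurableSet_singleton b), smul_eq_mul]
  rfl

/-- The chain rule for conditional probabilities. -/
lemma cpr_mul_cpr_inter [MeasureSpace Ω] [IsFiniteMeasure (ℙ : Measure Ω)] {A B : Set Ω}
    (hA : MeasurableSet A) (hB : MeasurableSet B) (C : Set Ω) :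
    cpr A B * cpr (A ∩ B) C = cpr A (B ∩ C) := by
  rw [cpr, cpr, cpr, ← cond_cond_eq_cond_inter hA hB, ← cond_mul_eq_inter hB, ENNReal.toReal_mul,
    mul_comm]

section LossImprovement

variable [MeasureSpace Ω] {𝒴 𝒳i : Type}
  [Fintype 𝒴] [MeasurableSpace 𝒴] [MeasurableSingletonClass 𝒴]
  [Fintype 𝒳i] [MeasurableSpace 𝒳i] [MeasurableSingletonClass 𝒳i]
  {Y : Ω → 𝒴} {Xi : Ω → 𝒳i}

lemma cexp_xent_eq_entropyOn (hY : Measurable Y) (A : Set Ω) :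
    cexp A (fun ω => xent (cpmf Y A) (Y ω)) = entropyOn Y A := by
  rw [cexp, integral_comp_of_fintype hY, entropyOn, ← Finset.sum_neg_distrib]
  exact Finset.sum_congr rfl fun y _ => mul_neg _ _

lemma cexp_xent_inter_eq_sum_entropyOn [IsFiniteMeasure (ℙ : Measure Ω)]
    (hY : Measurable Y) (hXi : Measurable Xi) {A : Set Ω} (hA : MeasurableSet A) :
    cexp A (fun ω => xent (cpmf Y (A ∩ {ω' | Xi ω' = Xi ω})) (Y ω))
      = ∑ xi, cpr A {ω | Xi ω = xi} * entropyOn Y (A ∩ {ω | Xi ω = xi}) := by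
  rw [cexp, integral_comp_of_fintype (hXi.prodMk hY)
    (fun b : 𝒳i × 𝒴 => xent (cpmf Y (A ∩ {ω' | Xi ω' = b.1})) b.2), Fintype.sum_prod_type]
  refine Finset.sum_congr rfl fun a _ => ?_
  rw [entropyOn, ← Finset.sum_neg_distrib, Finset.mul_sum]
  refine Finset.sum_congr rfl fun y _ => ?_
  have hset : {ω | (Xi ω, Y ω) = (a, y)} = {ω | Xi ω = a} ∩ {ω | Y ω = y} := by
    ext ω
    simp
  have hchain := cpr_mul_cpr_inter hA (hXi (measurableSet_singleton a)) {ω | Y ω = y}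
  change cpr A {ω | (Xi ω, Y ω) = (a, y)} * _ = _
  rw [hset]
  change cpr A {ω | Xi ω = a} * cpmf Y (A ∩ {ω | Xi ω = a}) y = _ at hchain
  change _ = cpr A ({ω | Xi ω = a} ∩ _) at hchain
  rw [← hchain, xent]
  ring

/-- The conditional mean of the incremental loss improvement is the conditional mutual
information. -/
lemma cexp_xent_sub_xent_eq_cmi [IsFiniteMeasure (ℙ : Measure Ω)]
    (hY : Measurable Y) (hXi : Measurable Xi) {A : Set Ω} (hA : MeasurableSet A) :
    cexp A (fun ω => xent (cpmf Y A) (Y ω)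
      - xent (cpmf Y (A ∩ {ω' | Xi ω' = Xi ω})) (Y ω)) = cmi Y Xi A := by
  rw [cmi, ← cexp_xent_eq_entropyOn hY, ← cexp_xent_inter_eq_sum_entropyOn hY hXi hA]
  exact integral_sub (integrable_comp_of_fintype hY _)
    (integrable_comp_of_fintype (hXi.prodMk hY)
      (fun b : 𝒳i × 𝒴 => xent (cpmf Y (A ∩ {ω' | Xi ω' = b.1})) b.2))

end LossImprovement

/-- The mean is the unique minimizer of the mean squared error. -/
lemma integral_sq_integral_sub_lt [MeasurableSpace Ω] {μ : Measure Ω} [IsProbabilityMeasure μ]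
    {g : Ω → ℝ} (hg : Integrable g μ) (hg2 : Integrable (fun ω => g ω ^ 2) μ) {v : ℝ}
    (hv : v ≠ ∫ ω, g ω ∂μ) :
    ∫ ω, ((∫ ω', g ω' ∂μ) - g ω) ^ 2 ∂μ < ∫ ω, (v - g ω) ^ 2 ∂μ := by
  have expand (c : ℝ) :
      ∫ ω, (c - g ω) ^ 2 ∂μ = c ^ 2 - 2 * c * (∫ ω, g ω ∂μ) + ∫ ω, g ω ^ 2 ∂μ := by
    simp_rw [sub_sq]
    have hlin : Integrable (fun ω => 2 * c * g ω) μ := hg.const_mul _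
    have hsub : Integrable (fun ω => c ^ 2 - 2 * c * g ω) μ := (integrable_const _).sub hlin
    rw [integral_add hsub hg2, integral_sub (integrable_const _) hlin, integral_const_mul]
    simp
  rw [expand, expand]
  have := sq_pos_of_ne_zero (sub_ne_zero.mpr hv)
  linarith

/-- **Theorem 2 (value-network part, pointwise form).** With prior information `Z`, the map
`v ↦ E[(v − Δ(x_S, X_i, z, Y))² | X_S = x_S, Z = z]` attains its minimum uniquely at
`v = I(Y; X_i | X_S = x_S, Z = z)`. -/
theorem value_network_unique_minimizer_prior
    [MeasureSpace Ω] [IsProbabilityMeasure (ℙ : Measure Ω)]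
    {𝒴 : Type} [Fintype 𝒴] [MeasurableSpace 𝒴] [MeasurableSingletonClass 𝒴]
    {𝒵 : Type} [Fintype 𝒵] [MeasurableSpace 𝒵] [MeasurableSingletonClass 𝒵]
    {d : ℕ} {𝒳 : Fin d → Type} [∀ i, Fintype (𝒳 i)]
    [∀ i, MeasurableSpace (𝒳 i)] [∀ i, MeasurableSingletonClass (𝒳 i)]
    (X : ∀ i, Ω → 𝒳 i) (Y : Ω → 𝒴) (Z : Ω → 𝒵)
    (hX : ∀ i, Measurable (X i)) (hY : Measurable Y) (hZ : Measurable Z)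
    (S : Finset (Fin d)) (i : Fin d) (hi : i ∉ S)
    (x : ∀ j, 𝒳 j) (z : 𝒵)
    (hpos : 0 < (ℙ : Measure Ω) (evS X S x ∩ {ω | Z ω = z})) :
    ∀ v : ℝ, v ≠ cmi Y (X i) (evS X S x ∩ {ω | Z ω = z}) →
      cexp (evS X S x ∩ {ω | Z ω = z}) (fun ω =>
          (cmi Y (X i) (evS X S x ∩ {ω' | Z ω' = z})
            - (xent (cpmf Y (evS X S x ∩ {ω' | Z ω' = z})) (Y ω)
              - xent (cpmf Y (evS X S x ∩ {ω' | Z ω' = z} ∩ {ω' | X i ω' = X i ω})) (Y ω))) ^ 2)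
        < cexp (evS X S x ∩ {ω | Z ω = z}) (fun ω =>
            (v - (xent (cpmf Y (evS X S x ∩ {ω' | Z ω' = z})) (Y ω)
              - xent (cpmf Y (evS X S x ∩ {ω' | Z ω' = z} ∩ {ω' | X i ω' = X i ω})) (Y ω))) ^ 2) := by
  intro v hv
  have hA : MeasurableSet (evS X S x ∩ {ω | Z ω = z}) :=
    (measurableSet_evS hX S x).inter (hZ (measurableSet_singleton z))
  generalize evS X S x ∩ {ω | Z ω = z} = A at *
  have := cond_isProbabilityMeasure (μ := (ℙ : Measure Ω)) hpos.ne'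
  let G (b : 𝒳 i × 𝒴) : ℝ :=
    xent (cpmf Y A) b.2 - xent (cpmf Y (A ∩ {ω' | X i ω' = b.1})) b.2
  have hW := (hX i).prodMk hY
  rw [← cexp_xent_sub_xent_eq_cmi hY (hX i) hA] at hv ⊢
  exact integral_sq_integral_sub_lt (integrable_comp_of_fintype hW G)
    (integrable_comp_of_fintype hW fun b => G b ^ 2) hv
end
end

section
/- (Theorem 3, value-network part, pointwise form) Fix a subset S ⊆ {1,…,d}, an index i ∉ S, and a value x_S with P(X_S = x_S) > 0. The function v ↦ E[(v − Δ(x_S, X_i, Y))² | X_S = x_S] on ℝ attains its minimum uniquely at v = Var(m(x_S, X_i) | X_S = x_S), the conditional variance of the updated conditional mean given the event X_S = x_S. -/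
open MeasureTheory ProbabilityTheory
open scoped ENNReal NNReal

noncomputable section

variable {Ω : Type}

section

variable {α : Type*} [MeasurableSpace Ω] {μ : Measure Ω}

/-- The mean squared distance to a constant is uniquely minimized at the expectation. -/
theorem integral_sq_sub_lt_of_ne_integral [IsProbabilityMeasure μ] {D : Ω → ℝ}
    (hD : MemLp D 2 μ) {v : ℝ} (hv : v ≠ ∫ ω, D ω ∂μ) :
    ∫ ω, ((∫ ω', D ω' ∂μ) - D ω) ^ 2 ∂μ < ∫ ω, (v - D ω) ^ 2 ∂μ := by
  have hD1 : Integrable D μ := hD.integrable one_le_two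
  have expand (c : ℝ) : ∫ ω, (c - D ω) ^ 2 ∂μ
      = c ^ 2 - 2 * c * ∫ ω, D ω ∂μ + ∫ ω, D ω ^ 2 ∂μ := by
    simp_rw [sub_sq]
    rw [integral_add (by fun_prop) hD.integrable_sq,
      integral_sub (integrable_const _) (hD1.const_mul _), integral_const_mul]
    simp
  rw [expand, expand]
  have := sq_pos_of_ne_zero (sub_ne_zero.mpr hv)
  nlinarith

variable [Fintype α] [MeasurableSpace α] [MeasurableSingletonClass α]

theorem memLp_top_comp_of_finite {X : Ω → α} (hX : Measurable X) (k : α → ℝ) :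
    MemLp (fun ω => k (X ω)) ⊤ μ :=
  memLp_top_of_bound ((measurable_of_finite k).comp hX).aestronglyMeasurable (∑ a, ‖k a‖)
    (.of_forall fun ω => Finset.single_le_sum (f := fun a => ‖k a‖)
      (fun _ _ => norm_nonneg _) (Finset.mem_univ (X ω)))

theorem integral_eq_sum_setIntegral_fiber {X : Ω → α} (hX : Measurable X) {f : Ω → ℝ}
    (hf : Integrable f μ) : ∫ ω, f ω ∂μ = ∑ a, ∫ ω in X ⁻¹' {a}, f ω ∂μ := by
  rw [← integral_iUnion_fintype (fun a => hX (measurableSet_singleton a))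
    (fun a b hab => Disjoint.preimage X (by simpa using hab)) (fun _ => hf.integrableOn),
    ← Set.preimage_iUnion, Set.iUnion_of_singleton, Set.preimage_univ, setIntegral_univ]

theorem setIntegral_eq_measureReal_mul_integral_cond [IsFiniteMeasure μ] (A : Set Ω)
    (f : Ω → ℝ) : ∫ ω in A, f ω ∂μ = μ.real A * ∫ ω, f ω ∂μ[|A] := by
  by_cases h : μ A = 0
  · simp [Measure.restrict_eq_zero.mpr h, measureReal_def, h]
  · have h' : μ.real A ≠ 0 := by simpa [measureReal_def, ENNReal.toReal_eq_zero_iff] using h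
    rw [ProbabilityTheory.cond, integral_smul_measure, ENNReal.toReal_inv, smul_eq_mul,
      ← measureReal_def, mul_inv_cancel_left₀ h']

/-- Functions of a finitely-valued `X` do not distinguish `Y` from its conditional mean
given `X`. -/
theorem integral_comp_mul_eq_integral_comp_mul_cond [IsFiniteMeasure μ] {X : Ω → α}
    (hX : Measurable X) {Y : Ω → ℝ} (hY : Integrable Y μ) (h : α → ℝ) :
    ∫ ω, h (X ω) * Y ω ∂μ = ∫ ω, h (X ω) * ∫ ω', Y ω' ∂μ[|X ⁻¹' {X ω}] ∂μ := by
  have hl : Integrable (fun ω => h (X ω) * Y ω) μ :=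
    hY.mul_of_top_right (memLp_top_comp_of_finite hX h)
  have hr : Integrable (fun ω => h (X ω) * ∫ ω', Y ω' ∂μ[|X ⁻¹' {X ω}]) μ :=
    (memLp_top_comp_of_finite hX fun a => h a * ∫ ω', Y ω' ∂μ[|X ⁻¹' {a}]).integrable le_top
  rw [integral_eq_sum_setIntegral_fiber hX hl, integral_eq_sum_setIntegral_fiber hX hr]
  refine Finset.sum_congr rfl fun a _ => ?_
  have hm : MeasurableSet (X ⁻¹' {a}) := hX (measurableSet_singleton a)
  rw [setIntegral_congr_fun (g := fun ω => h a * Y ω) hm (by rintro ω rfl; rfl),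
    setIntegral_congr_fun (f := fun ω => h (X ω) * ∫ ω', Y ω' ∂μ[|X ⁻¹' {X ω}])
      (g := fun _ => h a * ∫ ω', Y ω' ∂μ[|X ⁻¹' {a}]) hm (by rintro ω rfl; rfl),
    integral_const_mul, setIntegral_eq_measureReal_mul_integral_cond, setIntegral_const,
    smul_eq_mul]
  ring

/-- The incremental squared-error improvement of the conditional mean is square integrable, and
its expectation is the variance of the conditional mean. -/
theorem memLp_and_integral_incremental_loss [IsProbabilityMeasure μ] {X : Ω → α}
    (hX : Measurable X) {Y : Ω → ℝ} (hY : MemLp Y 2 μ) {g : α → ℝ}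
    (hg : ∀ a, g a = ∫ ω, Y ω ∂μ[|X ⁻¹' {a}]) :
    MemLp (fun ω => ((∫ ω', Y ω' ∂μ) - Y ω) ^ 2 - (g (X ω) - Y ω) ^ 2) 2 μ ∧
      ∫ ω, (((∫ ω', Y ω' ∂μ) - Y ω) ^ 2 - (g (X ω) - Y ω) ^ 2) ∂μ
        = variance (fun ω => g (X ω)) μ := by
  have hY1 : Integrable Y μ := hY.integrable one_le_two
  set m := ∫ ω, Y ω ∂μ
  have hform : (fun ω => (m - Y ω) ^ 2 - (g (X ω) - Y ω) ^ 2)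
      = fun ω => (m ^ 2 - g (X ω) ^ 2) + (2 * (g (X ω) - m)) * Y ω := by
    funext ω; ring
  have hA : MemLp (fun ω => m ^ 2 - g (X ω) ^ 2) ⊤ μ :=
    memLp_top_comp_of_finite hX fun a => m ^ 2 - g a ^ 2
  have hB : MemLp (fun ω => (2 * (g (X ω) - m)) * Y ω) 2 μ :=
    hY.mul (memLp_top_comp_of_finite hX fun a => 2 * (g a - m))
  have hg1 : Integrable (fun ω => g (X ω)) μ := (memLp_top_comp_of_finite hX g).integrable le_top
  have hg2 : Integrable (fun ω => g (X ω) ^ 2) μ :=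
    (memLp_top_comp_of_finite hX fun a => g a ^ 2).integrable le_top
  have hcond (h : α → ℝ) : ∫ ω, h (X ω) * Y ω ∂μ = ∫ ω, h (X ω) * g (X ω) ∂μ := by
    simpa only [hg] using integral_comp_mul_eq_integral_comp_mul_cond hX hY1 h
  have hmean : ∫ ω, g (X ω) ∂μ = m := by simpa using (hcond fun _ => 1).symm
  refine ⟨by rw [hform]; exact (hA.mono_exponent le_top).add hB, ?_⟩
  rw [hform, integral_add (hA.integrable le_top) (hB.integrable one_le_two),
    hcond fun a => 2 * (g a - m), integral_sub (integrable_const _) hg2,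
    variance_eq_sub ((memLp_top_comp_of_finite hX g).mono_exponent le_top), hmean]
  have hcross : ∫ ω, 2 * (g (X ω) - m) * g (X ω) ∂μ
      = 2 * ∫ ω, g (X ω) ^ 2 ∂μ - 2 * m * ∫ ω, g (X ω) ∂μ := by
    rw [← integral_const_mul, ← integral_const_mul, ← integral_sub (hg2.const_mul _)
      (hg1.const_mul _)]
    congr 1 with ω
    ring
  rw [hcross, hmean]
  simp only [integral_const, probReal_univ, smul_eq_mul, one_mul, Pi.pow_apply]
  ring

end

/-- **Theorem 3 (value-network part, pointwise form).** For the regression setting, the map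
`v ↦ E[(v − Δ(x_S, X_i, Y))² | X_S = x_S]` attains its minimum uniquely at
`v = Var(m(x_S, X_i) | X_S = x_S)`, the conditional variance of the updated conditional
mean. -/
theorem regression_value_network_unique_minimizer
    [MeasureSpace Ω] [IsProbabilityMeasure (ℙ : Measure Ω)]
    {d : ℕ} {𝒳 : Fin d → Type} [∀ i, Fintype (𝒳 i)]
    [∀ i, MeasurableSpace (𝒳 i)] [∀ i, MeasurableSingletonClass (𝒳 i)]
    (X : ∀ i, Ω → 𝒳 i) (Y : Ω → ℝ)
    (hX : ∀ i, Measurable (X i)) (hY : Measurable Y)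
    (hY2 : Integrable (fun ω => (Y ω) ^ 2) (ℙ : Measure Ω))
    (S : Finset (Fin d)) (i : Fin d) (hi : i ∉ S)
    (x : ∀ j, 𝒳 j) (hpos : 0 < (ℙ : Measure Ω) (evS X S x)) :
    ∀ v : ℝ, v ≠ cvar (evS X S x) (fun ω => cexp (evS X S x ∩ {ω' | X i ω' = X i ω}) Y) →
      cexp (evS X S x) (fun ω =>
          (cvar (evS X S x) (fun ω'' => cexp (evS X S x ∩ {ω' | X i ω' = X i ω''}) Y)
            - ((cexp (evS X S x) Y - Y ω) ^ 2
              - (cexp (evS X S x ∩ {ω' | X i ω' = X i ω}) Y - Y ω) ^ 2)) ^ 2)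
        < cexp (evS X S x) (fun ω =>
            (v - ((cexp (evS X S x) Y - Y ω) ^ 2
              - (cexp (evS X S x ∩ {ω' | X i ω' = X i ω}) Y - Y ω) ^ 2)) ^ 2) := by
  have hA : MeasurableSet (evS X S x) := by
    have : evS X S x = ⋂ j ∈ S, X j ⁻¹' {x j} := by ext; simp [evS]
    rw [this]
    exact S.measurableSet_biInter fun j _ => hX j (measurableSet_singleton _)
  set A := evS X S x
  have : IsProbabilityMeasure ((ℙ : Measure Ω)[|A]) := cond_isProbabilityMeasure hpos.ne'
  have hYL : MemLp Y 2 ((ℙ : Measure Ω)[|A]) :=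
    (((memLp_two_iff_integrable_sq hY.aestronglyMeasurable).mpr hY2).restrict A).smul_measure
      (ENNReal.inv_ne_top.mpr hpos.ne')
  have hg (a : 𝒳 i) : cexp (A ∩ {ω' | X i ω' = a}) Y
      = ∫ ω, Y ω ∂((ℙ : Measure Ω)[|A])[|X i ⁻¹' {a}] := by
    rw [cond_cond_eq_cond_inter hA (hX i (measurableSet_singleton a))]
    rfl
  obtain ⟨hD, hE⟩ := memLp_and_integral_incremental_loss (hX i) hYL hg
  intro v hv
  unfold cvar at hv ⊢
  rw [← hE] at hv ⊢
  exact integral_sq_sub_lt_of_ne_integral hD hv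
end
end

section
/- (Theorem 3) Let Y be real-valued with E[Y²] < ∞, and let 𝐒 be a random subset of {1,…,d} such that for every s ⊆ {1,…,d} and value x_s with P(𝐒 = s, X_s = x_s) > 0, the conditional distribution of (X_1,…,X_d, Y) given {𝐒 = s, X_s = x_s} equals its conditional distribution given {X_s = x_s}. Define f*(s, x_s) = E[Y | X_s = x_s] and v*_i(s, x_s) = Var(m(x_s, X_i) | X_s = x_s). Then: (i) for every predictor f assigning a real number to each pair (s, x_s), E[(f(𝐒, X_𝐒) − Y)²] ≥ E[(f*(𝐒, X_𝐒) − Y)²]; and (ii) for every value function v assigning a vector in ℝ^d to each pair (s, x_s), E[(1/d) ∑_{i=1}^d (v_i(𝐒, X_𝐒) − Δ_i)²] ≥ E[(1/d) ∑_{i=1}^d (v*_i(𝐒, X_𝐒) − Δ_i)²], where Δ_i = (f*(𝐒, X_𝐒) − Y)² − (f*(𝐒 ∪ {i}, X_{𝐒∪{i}}) − Y)². -/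
open MeasureTheory ProbabilityTheory
open scoped ENNReal NNReal

noncomputable section

variable {Ω : Type}

section FiniteConditioning

variable {α ι : Type*} [MeasurableSpace α] [MeasurableSpace ι] [DiscreteMeasurableSpace ι]

/-- The law of total expectation over the fibres of a finitely-valued map. -/
lemma integral_eq_sum_cond_fiber [Fintype ι] {μ : Measure α} [IsFiniteMeasure μ] {T : α → ι}
    (hT : Measurable T) {φ : α → ℝ} (hφ : Integrable φ μ) :
    ∫ a, φ a ∂μ = ∑ t, μ.real (T ⁻¹' {t}) * ∫ a, φ a ∂μ[|T ⁻¹' {t}] := by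
  have hμ := sum_meas_smul_cond_fiber hT μ
  have hint : ∀ t ∈ Finset.univ, Integrable φ (μ (T ⁻¹' {t}) • μ[|T ⁻¹' {t}]) := fun t ht =>
    hφ.mono_measure <| by
      conv_rhs => rw [← hμ]
      exact Finset.single_le_sum
        (f := fun t => μ (T ⁻¹' {t}) • μ[|T ⁻¹' {t}]) (fun _ _ => Measure.zero_le _) ht
  conv_lhs => rw [← hμ]
  rw [integral_finsetSum_measure hint]
  simp only [integral_smul_measure, smul_eq_mul, Measure.real]

lemma memLp_comp_of_finite [Finite ι] {μ : Measure α} [IsFiniteMeasure μ] {T : α → ι}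
    (hT : Measurable T) (g : ι → ℝ) (p : ℝ≥0∞) : MemLp (fun a => g (T a)) p μ :=
  (MemLp.of_discrete (μ := μ.map T) (f := g)).comp_of_map hT.aemeasurable

lemma memLp_mul_comp_of_finite [Finite ι] {μ : Measure α} [IsFiniteMeasure μ] {T : α → ι}
    (hT : Measurable T) (g : ι → ℝ) {p : ℝ≥0∞} {Z : α → ℝ} (hZ : MemLp Z p μ) :
    MemLp (fun a => g (T a) * Z a) p μ :=
  hZ.mul' (memLp_comp_of_finite hT g ∞)

lemma MeasureTheory.MemLp.cond {μ : Measure α} {p : ℝ≥0∞} {Z : α → ℝ}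
    (hZ : MemLp Z p μ) (s : Set α) : MemLp Z p μ[|s] := by
  by_cases hs : μ s = 0
  · simp [cond_eq_zero_of_meas_eq_zero hs]
  · exact hZ.restrict s |>.smul_measure (ENNReal.inv_ne_top.2 hs)

/-- Functions of a finitely-valued map integrate against `Z` as against the fibre means of `Z`. -/
lemma integral_comp_mul_eq_of_fiber_means [Fintype ι] {μ : Measure α} [IsFiniteMeasure μ]
    {T : α → ι} (hT : Measurable T) {Z : α → ℝ} (hZ : Integrable Z μ) {g : ι → ℝ}
    (hg : ∀ t, μ (T ⁻¹' {t}) ≠ 0 → ∫ a, Z a ∂μ[|T ⁻¹' {t}] = g t) (h : ι → ℝ) :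
    ∫ a, h (T a) * Z a ∂μ = ∫ a, h (T a) * g (T a) ∂μ := by
  rw [integral_eq_sum_cond_fiber hT
      ((memLp_mul_comp_of_finite hT h (memLp_one_iff_integrable.2 hZ)).integrable le_rfl),
    integral_eq_sum_cond_fiber hT
      ((memLp_comp_of_finite hT (fun t => h t * g t) 1).integrable le_rfl)]
  refine Finset.sum_congr rfl fun t _ => ?_
  by_cases ht : μ (T ⁻¹' {t}) = 0
  · simp [Measure.real, ht]
  have hae : ∀ᵐ a ∂μ[|T ⁻¹' {t}], T a = t := ae_cond_mem (hT (.singleton t))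
  have := cond_isProbabilityMeasure ht
  rw [integral_congr_ae (g := fun a => h t * Z a) (by filter_upwards [hae] with a ha; rw [ha]),
    integral_congr_ae (f := fun a => h (T a) * g (T a)) (g := fun _ => h t * g t)
      (by filter_upwards [hae] with a ha; rw [ha]),
    integral_const_mul, hg t ht, integral_const, probReal_univ, one_smul]

/-- Among functions that are constant on the fibres of a finitely-valued map, the fibre means
minimize the mean squared error. -/
lemma integral_sq_sub_le_of_fiber_means [Fintype ι] {μ : Measure α} [IsFiniteMeasure μ]
    {T : α → ι} (hT : Measurable T) {Z G H : α → ℝ} (hZ : MemLp Z 2 μ)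
    (hG : Function.FactorsThrough G T) (hH : Function.FactorsThrough H T)
    (hmean : ∀ a, μ (T ⁻¹' {T a}) ≠ 0 → ∫ b, Z b ∂μ[|T ⁻¹' {T a}] = G a) :
    ∫ a, (G a - Z a) ^ 2 ∂μ ≤ ∫ a, (H a - Z a) ^ 2 ∂μ := by
  obtain ⟨g, rfl⟩ := (Function.factorsThrough_iff G).1 hG
  obtain ⟨h, rfl⟩ := (Function.factorsThrough_iff H).1 hH
  have hg : ∀ t, μ (T ⁻¹' {t}) ≠ 0 → ∫ a, Z a ∂μ[|T ⁻¹' {t}] = g t := by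
    intro t ht
    obtain ⟨a, rfl⟩ := nonempty_of_measure_ne_zero ht
    exact hmean a ht
  have hZ1 : Integrable Z μ := hZ.integrable one_le_two
  have hcross := integral_comp_mul_eq_of_fiber_means hT hZ1 hg (fun t => h t - g t)
  have hi (k : ι → ℝ) : Integrable (fun a => (k (T a) - Z a) ^ 2) μ :=
    ((memLp_comp_of_finite hT k 2).sub hZ).integrable_sq
  have hiZ : Integrable (fun a => (h (T a) - g (T a)) * Z a) μ :=
    (memLp_mul_comp_of_finite hT (fun t => h t - g t)
      (memLp_one_iff_integrable.2 hZ1)).integrable le_rfl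
  have hik (k : ι → ℝ) : Integrable (fun a => k (T a)) μ :=
    (memLp_comp_of_finite hT k 1).integrable le_rfl
  have hig := hik fun t => (h t - g t) * g t
  have hsq := hik fun t => (h t - g t) ^ 2
  have hdiff : ∫ a, (h (T a) - Z a) ^ 2 ∂μ - ∫ a, (g (T a) - Z a) ^ 2 ∂μ
      = ∫ a, (h (T a) - g (T a)) ^ 2 ∂μ := by
    rw [← integral_sub (hi h) (hi g)]
    have : ∀ a, (h (T a) - Z a) ^ 2 - (g (T a) - Z a) ^ 2 = (h (T a) - g (T a)) ^ 2
        + 2 * ((h (T a) - g (T a)) * g (T a) - (h (T a) - g (T a)) * Z a) := fun a => by ring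
    simp_rw [this]
    rw [integral_add hsq (by fun_prop), integral_const_mul, integral_sub hig hiZ,
      hcross, sub_self, mul_zero, add_zero]
  have : 0 ≤ ∫ a, (h (T a) - g (T a)) ^ 2 ∂μ := integral_nonneg fun a => sq_nonneg _
  simp only [Function.comp_apply]
  linarith

/-- The expected drop in squared error when the mean of `Y` is replaced by its fibre means is the
variance of the fibre means. -/
lemma integral_sq_sub_sq_eq_variance_fiber_means [Fintype ι] {μ : Measure α}
    [IsProbabilityMeasure μ] {T : α → ι} (hT : Measurable T) {Y : α → ℝ} (hY : MemLp Y 2 μ)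
    {g : ι → ℝ} (hg : ∀ t, μ (T ⁻¹' {t}) ≠ 0 → ∫ a, Y a ∂μ[|T ⁻¹' {t}] = g t) :
    ∫ a, ((∫ b, Y b ∂μ - Y a) ^ 2 - (g (T a) - Y a) ^ 2) ∂μ
      = variance (fun a => g (T a)) μ := by
  have hY1 : Integrable Y μ := hY.integrable one_le_two
  have hmean : ∫ a, Y a ∂μ = ∫ a, g (T a) ∂μ := by
    simpa using integral_comp_mul_eq_of_fiber_means hT hY1 hg fun _ => 1
  have hcross := integral_comp_mul_eq_of_fiber_means hT hY1 hg g
  have hsq : Integrable (fun a => g (T a) * g (T a)) μ :=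
    (memLp_comp_of_finite hT (fun t => g t * g t) 1).integrable le_rfl
  have higY : Integrable (fun a => g (T a) * Y a) μ :=
    (memLp_mul_comp_of_finite hT g (memLp_one_iff_integrable.2 hY1)).integrable le_rfl
  rw [variance_eq_sub (memLp_comp_of_finite hT g 2), ← hmean]
  set c := ∫ a, Y a ∂μ with hc
  have : ∀ a, (c - Y a) ^ 2 - (g (T a) - Y a) ^ 2
      = (c ^ 2 - 2 * c * Y a) + (2 * (g (T a) * Y a) - g (T a) * g (T a)) := fun a => by ring
  simp_rw [this]
  rw [integral_add (by fun_prop) (by fun_prop),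
    integral_sub (integrable_const _) (hY1.const_mul _), integral_sub (higY.const_mul 2) hsq,
    integral_const_mul, integral_const_mul, hcross, ← hc, integral_const, probReal_univ, one_smul]
  simp only [Pi.pow_apply, ← pow_two]
  ring

/-- Two finite laws of a pair with finitely-valued first coordinate agree once they agree on
`{U = u, Y ∈ B}`. -/
lemma map_prodMk_eq_of_forall_fiber [Finite ι] {μ ν : Measure α} [IsFiniteMeasure μ]
    {U : α → ι} {Y : α → ℝ} (hU : Measurable U) (hY : Measurable Y)
    (h : ∀ u B, MeasurableSet B → μ {a | U a = u ∧ Y a ∈ B} = ν {a | U a = u ∧ Y a ∈ B}) :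
    μ.map (fun a => (U a, Y a)) = ν.map (fun a => (U a, Y a)) := by
  have := Fintype.ofFinite ι
  classical
  refine Measure.ext_prod fun {s B} hs hB => ?_
  rw [Measure.map_apply (hU.prodMk hY) (hs.prod hB), Measure.map_apply (hU.prodMk hY) (hs.prod hB)]
  have hunion : (fun a => (U a, Y a)) ⁻¹' s ×ˢ B
      = ⋃ u ∈ s.toFinset, {a | U a = u ∧ Y a ∈ B} := by
    ext a; simp
  have hdisj : (s.toFinset : Set ι).PairwiseDisjoint fun u => {a | U a = u ∧ Y a ∈ B} :=
    fun u _ u' _ hne => Set.disjoint_left.2 fun a ha ha' => hne (ha.1.symm.trans ha'.1)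
  have hmeas : ∀ u ∈ s.toFinset, MeasurableSet {a | U a = u ∧ Y a ∈ B} := fun u _ =>
    (hU (.singleton u)).inter (hY hB)
  rw [hunion, measure_biUnion_finset hdisj hmeas, measure_biUnion_finset hdisj hmeas]
  exact Finset.sum_congr rfl fun u _ => h u B hB

end FiniteConditioning

lemma evS_congr {d : ℕ} {𝒳 : Fin d → Type} (X : ∀ i, Ω → 𝒳 i) {S : Finset (Fin d)}
    {x x' : ∀ i, 𝒳 i} (h : ∀ j ∈ S, x j = x' j) : evS X S x = evS X S x' := by
  ext ω
  exact forall₂_congr fun j hj => by rw [h j hj]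

lemma evS_insert_of_mem {d : ℕ} {𝒳 : Fin d → Type} (X : ∀ i, Ω → 𝒳 i) {S : Finset (Fin d)}
    {x : ∀ i, 𝒳 i} {ω : Ω} (hω : ω ∈ evS X S x) (i : Fin d) :
    evS X (insert i S) (fun j => X j ω) = evS X S x ∩ {ω' | X i ω' = X i ω} := by
  rw [← evS_congr X hω]
  ext ω'
  simp [evS, and_comm]

/-- **Theorem 3.** For the regression setting with squared-error loss, the objectives for the
predictor and the value network are jointly optimized by the conditional mean
`f*(s, x_s) = E[Y | X_s = x_s]` and the value network
`v*_i(s, x_s) = Var(m(x_s, X_i) | X_s = x_s)`. -/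
theorem theorem3_regression_joint_optimality
    [MeasureSpace Ω] [IsProbabilityMeasure (ℙ : Measure Ω)]
    {d : ℕ} {𝒳 : Fin d → Type} [∀ i, Fintype (𝒳 i)]
    [∀ i, MeasurableSpace (𝒳 i)] [∀ i, MeasurableSingletonClass (𝒳 i)]
    (X : ∀ i, Ω → 𝒳 i) (Y : Ω → ℝ) (𝒮 : Ω → Finset (Fin d))
    (hX : ∀ i, Measurable (X i)) (hY : Measurable Y)
    (hY2 : Integrable (fun ω => (Y ω) ^ 2) (ℙ : Measure Ω))
    (h𝒮 : ∀ s, MeasurableSet {ω | 𝒮 ω = s})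
    (hcompat : ∀ (s : Finset (Fin d)) (x : ∀ j, 𝒳 j),
      0 < (ℙ : Measure Ω) ({ω | 𝒮 ω = s} ∩ evS X s x) →
      ∀ (x' : ∀ j, 𝒳 j) (B : Set ℝ), MeasurableSet B →
        ((ℙ : Measure Ω)[|{ω | 𝒮 ω = s} ∩ evS X s x]) {ω | (∀ j, X j ω = x' j) ∧ Y ω ∈ B}
          = ((ℙ : Measure Ω)[|evS X s x]) {ω | (∀ j, X j ω = x' j) ∧ Y ω ∈ B}) :
    -- (i) the conditional mean minimizes the expected squared-error loss
    (∀ f : Finset (Fin d) → (∀ j, 𝒳 j) → ℝ,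
      (∀ s x x', (∀ j ∈ s, x j = x' j) → f s x = f s x') →
      (∫ ω, (cexp (evS X (𝒮 ω) (fun j => X j ω)) Y - Y ω) ^ 2 ∂(ℙ : Measure Ω))
        ≤ ∫ ω, (f (𝒮 ω) (fun j => X j ω) - Y ω) ^ 2 ∂(ℙ : Measure Ω))
    ∧
    -- (ii) the conditional variance of the updated conditional mean minimizes the expected
    -- squared error against the incremental loss improvements
    (∀ v : Finset (Fin d) → (∀ j, 𝒳 j) → Fin d → ℝ,
      (∀ s x x', (∀ j ∈ s, x j = x' j) → v s x = v s x') →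
      (∫ ω, ((1 : ℝ) / d) * ∑ i,
          (cvar (evS X (𝒮 ω) (fun j => X j ω))
              (fun ω' => cexp (evS X (𝒮 ω) (fun j => X j ω) ∩ {ω'' | X i ω'' = X i ω'}) Y)
            - ((cexp (evS X (𝒮 ω) (fun j => X j ω)) Y - Y ω) ^ 2
              - (cexp (evS X (insert i (𝒮 ω)) (fun j => X j ω)) Y - Y ω) ^ 2)) ^ 2
          ∂(ℙ : Measure Ω))
        ≤ ∫ ω, ((1 : ℝ) / d) * ∑ i,
            (v (𝒮 ω) (fun j => X j ω) i
              - ((cexp (evS X (𝒮 ω) (fun j => X j ω)) Y - Y ω) ^ 2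
                - (cexp (evS X (insert i (𝒮 ω)) (fun j => X j ω)) Y - Y ω) ^ 2)) ^ 2
          ∂(ℙ : Measure Ω)) := by
  classical
  let : MeasurableSpace (Finset (Fin d)) := ⊤
  have : DiscreteMeasurableSpace (Finset (Fin d)) := ⟨fun _ => trivial⟩
  have hYL : MemLp Y 2 (ℙ : Measure Ω) :=
    (memLp_two_iff_integrable_sq hY.aestronglyMeasurable).2 hY2
  have hXm : Measurable fun ω j => X j ω := measurable_pi_lambda _ hX
  have h𝒮m : Measurable 𝒮 := measurable_to_countable' h𝒮
  have hU : Measurable fun ω => (𝒮 ω, fun j => X j ω) := h𝒮m.prodMk hXm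
  have hevS (s : Finset (Fin d)) (x : ∀ j, 𝒳 j) : MeasurableSet (evS X s x) := by
    have : evS X s x = (fun ω j => X j ω) ⁻¹' {x' | ∀ i ∈ s, x' i = x i} := rfl
    rw [this]
    exact hXm (Set.toFinite _).measurableSet
  -- `T` records the observed pair `(𝒮, X_𝒮)`
  let T : Ω → Finset (Fin d) × (∀ j, Option (𝒳 j)) :=
    fun ω => (𝒮 ω, fun j => if j ∈ 𝒮 ω then some (X j ω) else none)
  let : MeasurableSpace (Finset (Fin d) × (∀ j, Option (𝒳 j))) := ⊤
  have : DiscreteMeasurableSpace (Finset (Fin d) × (∀ j, Option (𝒳 j))) := ⟨fun _ => trivial⟩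
  have hT : Measurable T :=
    (Measurable.of_discrete (f := fun p : Finset (Fin d) × (∀ j, 𝒳 j) =>
      ((p.1, fun j => if j ∈ p.1 then some (p.2 j) else none) :
        Finset (Fin d) × (∀ j, Option (𝒳 j))))).comp hU
  have hT_iff (ω ω' : Ω) : T ω = T ω' ↔ 𝒮 ω = 𝒮 ω' ∧ ∀ j ∈ 𝒮 ω', X j ω = X j ω' := by
    simp only [T, Prod.mk.injEq]
    refine and_congr_right fun hs => ?_
    rw [hs, funext_iff]
    refine forall_congr' fun j => ?_
    by_cases hj : j ∈ 𝒮 ω' <;> simp [hj]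
  have hfiber (ω₀ : Ω) :
      T ⁻¹' {T ω₀} = {ω | 𝒮 ω = 𝒮 ω₀} ∩ evS X (𝒮 ω₀) (fun j => X j ω₀) := by
    ext ω
    exact hT_iff ω ω₀
  have htransfer (ω₀ : Ω) (hω₀ : (ℙ : Measure Ω) (T ⁻¹' {T ω₀}) ≠ 0)
      (ψ : (∀ j, 𝒳 j) × ℝ → ℝ) (hψ : Measurable ψ) :
      ∫ ω, ψ (fun j => X j ω, Y ω) ∂(ℙ : Measure Ω)[|T ⁻¹' {T ω₀}]
        = ∫ ω, ψ (fun j => X j ω, Y ω) ∂(ℙ : Measure Ω)[|evS X (𝒮 ω₀) (fun j => X j ω₀)] := by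
    have hmap := map_prodMk_eq_of_forall_fiber
      (μ := (ℙ : Measure Ω)[|T ⁻¹' {T ω₀}])
      (ν := (ℙ : Measure Ω)[|evS X (𝒮 ω₀) (fun j => X j ω₀)]) hXm hY fun x' B hB => by
        rw [hfiber] at hω₀ ⊢
        simpa only [funext_iff] using hcompat _ _ (pos_iff_ne_zero.2 hω₀) x' B hB
    have hmeas : Measurable fun ω => ((fun j => X j ω, Y ω) : (∀ j, 𝒳 j) × ℝ) := hXm.prodMk hY
    rw [← integral_map (φ := fun ω => ((fun j => X j ω, Y ω) : (∀ j, 𝒳 j) × ℝ))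
        hmeas.aemeasurable hψ.aestronglyMeasurable,
      ← integral_map (φ := fun ω => ((fun j => X j ω, Y ω) : (∀ j, 𝒳 j) × ℝ))
        hmeas.aemeasurable hψ.aestronglyMeasurable, hmap]
  have hfactor {β : Type} (F : Finset (Fin d) → (∀ j, 𝒳 j) → β)
      (hF : ∀ s x x', (∀ j ∈ s, x j = x' j) → F s x = F s x') :
      Function.FactorsThrough (fun ω => F (𝒮 ω) (fun j => X j ω)) T := by
    intro ω ω' h
    obtain ⟨hs, hx⟩ := (hT_iff ω ω').1 h
    simp only [hs]
    exact hF _ _ _ hx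
  have hfactor_evS {β : Type} (F : Set Ω → β) :
      Function.FactorsThrough (fun ω => F (evS X (𝒮 ω) (fun j => X j ω))) T :=
    hfactor (fun s x => F (evS X s x)) fun s x x' h => by rw [evS_congr X h]
  refine ⟨fun f hf => ?_, fun v hv => ?_⟩
  · exact integral_sq_sub_le_of_fiber_means hT hYL (hfactor_evS fun A => cexp A Y) (hfactor f hf)
      fun ω₀ hω₀ => htransfer ω₀ hω₀ Prod.snd measurable_snd
  have hΔ (i : Fin d) : MemLp (fun ω => (cexp (evS X (𝒮 ω) (fun j => X j ω)) Y - Y ω) ^ 2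
      - (cexp (evS X (insert i (𝒮 ω)) (fun j => X j ω)) Y - Y ω) ^ 2) 2 (ℙ : Measure Ω) := by
    let a : Finset (Fin d) × (∀ j, 𝒳 j) → ℝ := fun p => cexp (evS X p.1 p.2) Y
    let b : Finset (Fin d) × (∀ j, 𝒳 j) → ℝ := fun p => cexp (evS X (insert i p.1) p.2) Y
    convert (memLp_comp_of_finite hU (fun p => a p ^ 2 - b p ^ 2) 2).add
      (memLp_mul_comp_of_finite hU (fun p => 2 * (b p - a p)) hYL) using 1
    ext ω
    simp only [Pi.add_apply, a, b]
    ring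
  have hint (i : Fin d) {G : Ω → ℝ} (hG : Function.FactorsThrough G T) :
      Integrable (fun ω => (G ω - ((cexp (evS X (𝒮 ω) (fun j => X j ω)) Y - Y ω) ^ 2
        - (cexp (evS X (insert i (𝒮 ω)) (fun j => X j ω)) Y - Y ω) ^ 2)) ^ 2)
        (ℙ : Measure Ω) := by
    obtain ⟨g, rfl⟩ := (Function.factorsThrough_iff G).1 hG
    exact ((memLp_comp_of_finite hT g 2).sub (hΔ i)).integrable_sq
  have hcvar (i : Fin d) := hfactor_evS fun A =>
    cvar A (fun ω' => cexp (A ∩ {ω'' | X i ω'' = X i ω'}) Y)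
  have hv' (i : Fin d) := hfactor (fun s x => v s x i) fun s x x' h => by rw [hv s x x' h]
  rw [integral_const_mul, integral_const_mul, integral_finsetSum _ fun i _ => hint i (hcvar i),
    integral_finsetSum _ fun i _ => hint i (hv' i)]
  refine mul_le_mul_of_nonneg_left (Finset.sum_le_sum fun i _ => ?_) (by positivity)
  refine integral_sq_sub_le_of_fiber_means hT (hΔ i) (hcvar i) (hv' i) fun ω₀ hω₀ => ?_
  set A := evS X (𝒮 ω₀) (fun j => X j ω₀) with hA
  have hAm : MeasurableSet A := hevS _ _
  have hA0 : (ℙ : Measure Ω) A ≠ 0 := fun h0 =>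
    hω₀ (measure_mono_null (by rw [hfiber]; exact Set.inter_subset_right) h0)
  have := cond_isProbabilityMeasure hA0
  let b : (∀ j, 𝒳 j) → ℝ := fun x => cexp (evS X (insert i (𝒮 ω₀)) x) Y
  calc ∫ ω, ((cexp (evS X (𝒮 ω) (fun j => X j ω)) Y - Y ω) ^ 2
        - (cexp (evS X (insert i (𝒮 ω)) (fun j => X j ω)) Y - Y ω) ^ 2)
        ∂(ℙ : Measure Ω)[|T ⁻¹' {T ω₀}]
      = ∫ ω, ((cexp A Y - Y ω) ^ 2 - (b (fun j => X j ω) - Y ω) ^ 2)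
        ∂(ℙ : Measure Ω)[|T ⁻¹' {T ω₀}] := by
        refine integral_congr_ae ?_
        filter_upwards [ae_cond_mem (hT (.singleton (T ω₀)))] with ω hω
        obtain ⟨hs, hx⟩ := (hT_iff ω ω₀).1 hω
        simp only [hs, b, hA, evS_congr X hx]
    _ = ∫ ω, ((cexp A Y - Y ω) ^ 2 - (b (fun j => X j ω) - Y ω) ^ 2) ∂(ℙ : Measure Ω)[|A] :=
        htransfer ω₀ hω₀ (fun p => (cexp A Y - p.2) ^ 2 - (b p.1 - p.2) ^ 2) (by
          have : Measurable b := .of_discrete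
          fun_prop)
    _ = ∫ ω, ((cexp A Y - Y ω) ^ 2 - (cexp (A ∩ {ω' | X i ω' = X i ω}) Y - Y ω) ^ 2)
          ∂(ℙ : Measure Ω)[|A] := by
        refine integral_congr_ae ?_
        filter_upwards [ae_cond_mem hAm] with ω hω
        simp only [b, evS_insert_of_mem X hω i]
        rfl
    _ = cvar A (fun ω' => cexp (A ∩ {ω'' | X i ω'' = X i ω'}) Y) :=
        integral_sq_sub_sq_eq_variance_fiber_means (hX i) (hYL.cond A)
          (g := fun k => cexp (A ∩ {ω | X i ω = k}) Y) fun k _ => by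
            rw [cond_cond_eq_cond_inter hAm (hX i (.singleton k))]
            rfl
end
end
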